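/- Let m ≥ 1, J ≥ 3, let w : Fin m → ℝ be positive weights with Σ_i w_i = 1, let Θ be a nonempty set, and let π : Θ → Fin m → Fin J → ℝ satisfy 0 < π θ i j and Σ_j π θ i j = 1 for every θ ∈ Θ and every i. Fix θ₀ ∈ Θ and a permutation σ₀ of Fin J, and set p_{ij} = π θ₀ i (σ₀⁻¹ j). On a probability space, let (Z_l)_{l∈ℕ} be an i.i.d. sequence of random variables with values in Fin m × Fin J and with ℙ(Z_l = (i,j)) = w_i · p_{ij}. For N ∈ ℕ let Y^N_{ij} = #{l < N : Z_l = (i,j)}, and for θ ∈ Θ and a permutation σ define l_N(θ, σ) = Σ_{i=1}^m Σ_{j=1}^J Y^N_{ij} · log π θ i (σ⁻¹ j). Suppose for each N there are maps θ̂_N (into Θ) and σ̂_N (into permutations of Fin J) on the sample space such that, for every outcome ω and every N, l_N(θ̂_N(ω), σ̂_N(ω))(ω) ≥ l_N(θ, σ)(ω) for all θ ∈ Θ and all permutations σ. Then, with l_0 := Σ_{i=1}^m Σ_{j=1}^J w_i p_{ij} log p_{ij} < 0, almost surely as N → ∞: N^{−1} |l_N(θ̂_N, σ̂_N) − l_N(θ₀,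 σ₀)| → 0, N^{−1} l_N(θ̂_N, σ̂_N) → l_0, and l_N(θ₀, σ₀) / l_N(θ̂_N, σ̂_N) → 1. -/

import Mathlib

open MeasureTheory ProbabilityTheory Filter

/-- The (reduced) log-likelihood of the first `N` observations summarized as counts:
`l_N(θ, σ) = Σ_{i,j} Y^N_{ij} · log π θ i (σ⁻¹ j)`, where
`Y^N_{ij}(ω) = #{l < N : Z_l(ω) = (i,j)}`. -/
noncomputable def llik {Ω Θ : Type*} {m J : ℕ} (Z : ℕ → Ω → Fin m × Fin J)
    (π : Θ → Fin m → Fin J → ℝ) (N : ℕ) (ω : Ω) (θ : Θ) (σ : Equiv.Perm (Fin J)) : ℝ :=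
  ∑ i, ∑ j,
    ((((Finset.range N).filter (fun l => Z l ω = (i, j))).card : ℕ) : ℝ) *
      Real.log (π θ i (σ⁻¹ j))

/-- Strong law of large numbers for empirical frequencies. -/
theorem tendsto_count_div_ae {Ω α : Type*} [MeasurableSpace Ω] {P : Measure Ω}
    [IsProbabilityMeasure P] [MeasurableSpace α] [MeasurableSingletonClass α] [DecidableEq α]
    {Z : ℕ → Ω → α} (hindep : Pairwise (Function.onFun (fun f g => IndepFun f g P) Z))
    (hident : ∀ l, IdentDistrib (Z l) (Z 0) P P) (a : α) :
    ∀ᵐ ω ∂P, Tendsto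
      (fun N : ℕ => (((Finset.range N).filter (fun l => Z l ω = a)).card : ℝ) / N)
      atTop (nhds (P.real {ω | Z 0 ω = a})) := by
  have hf : Measurable (({a} : Set α).indicator (fun _ => (1 : ℝ))) :=
    measurable_const.indicator (measurableSet_singleton a)
  have hZ : AEMeasurable (Z 0) P := (hident 0).aemeasurable_fst
  have hint : Integrable (({a} : Set α).indicator (fun _ => (1 : ℝ)) ∘ Z 0) P := by
    refine Integrable.of_bound (hf.comp_aemeasurable hZ).aestronglyMeasurable 1 (ae_of_all _ ?_)
    intro ω
    by_cases h : Z 0 ω = a <;> simp [h]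
  have hmean : ∫ ω, (({a} : Set α).indicator (fun _ => (1 : ℝ)) ∘ Z 0) ω ∂P
      = P.real {ω | Z 0 ω = a} := by
    have h0 : NullMeasurableSet (Z 0 ⁻¹' {a}) P :=
      hZ.nullMeasurableSet_preimage (measurableSet_singleton a)
    have h1 : ({a} : Set α).indicator (fun _ => (1 : ℝ)) ∘ Z 0
        = (Z 0 ⁻¹' {a}).indicator (fun _ => (1 : ℝ)) := rfl
    rw [h1, integral_indicator₀ h0]
    simp
    rfl
  have hlaw := strong_law_ae_real
    (fun l => ({a} : Set α).indicator (fun _ => (1 : ℝ)) ∘ Z l) hint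
    (fun k l hkl => (hindep hkl).comp hf hf) (fun l => (hident l).comp hf)
  rw [hmean] at hlaw
  filter_upwards [hlaw] with ω h
  simpa [Pi.single_apply, Finset.sum_boole] using h

/-- Gibbs' inequality for unnormalized nonnegative weights `y`. -/
theorem sum_mul_log_le_sum_mul_log_div_sum {ι : Type*} [Fintype ι] {y q : ι → ℝ}
    (hy : ∀ j, 0 ≤ y j) (hq : ∀ j, 0 < q j) (hqsum : ∑ j, q j = 1) :
    ∑ j, y j * Real.log (q j) ≤ ∑ j, y j * Real.log (y j / ∑ k, y k) := by
  have hn : 0 ≤ ∑ k, y k := Finset.sum_nonneg fun k _ => hy k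
  have key : ∀ j, y j * Real.log (q j) - y j * Real.log (y j / ∑ k, y k)
      ≤ (∑ k, y k) * q j - y j := by
    intro j
    rcases (hy j).eq_or_lt with h | h
    · simpa [← h] using mul_nonneg hn (hq j).le
    · have hn' : 0 < ∑ k, y k :=
        h.trans_le (Finset.single_le_sum (fun k _ => hy k) (Finset.mem_univ j))
      have hr : 0 < y j / ∑ k, y k := div_pos h hn'
      have hlog := Real.log_le_sub_one_of_pos (div_pos (hq j) hr)
      rw [Real.log_div (hq j).ne' hr.ne'] at hlog
      calc y j * Real.log (q j) - y j * Real.log (y j / ∑ k, y k)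
          = y j * (Real.log (q j) - Real.log (y j / ∑ k, y k)) := by ring
        _ ≤ y j * (q j / (y j / ∑ k, y k) - 1) := mul_le_mul_of_nonneg_left hlog h.le
        _ = (∑ k, y k) * q j - y j := by field_simp
  have hle := Finset.sum_le_sum fun j (_ : j ∈ Finset.univ) => key j
  rw [Finset.sum_sub_distrib, Finset.sum_sub_distrib, ← Finset.mul_sum, hqsum] at hle
  linarith

/-- A probability vector with positive entries and at least two of them has entries below `1`. -/
theorem lt_one_of_pos_of_sum_eq_one {ι : Type*} [Fintype ι] [Nontrivial ι] {q : ι → ℝ}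
    (hq : ∀ j, 0 < q j) (hqsum : ∑ j, q j = 1) (j : ι) : q j < 1 := by
  obtain ⟨k, hk⟩ := exists_ne j
  rw [← hqsum]
  exact Finset.single_lt_sum hk (Finset.mem_univ j) (Finset.mem_univ k) (hq k)
    fun i _ _ => (hq i).le

/-- The average log-likelihood expressed through empirical frequencies. -/
theorem inv_mul_llik {Ω Θ : Type*} {m J : ℕ} (Z : ℕ → Ω → Fin m × Fin J)
    (π : Θ → Fin m → Fin J → ℝ) (N : ℕ) (ω : Ω) (θ : Θ) (σ : Equiv.Perm (Fin J)) :
    (N : ℝ)⁻¹ * llik Z π N ω θ σ = ∑ i, ∑ j,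
      (((Finset.range N).filter (fun l => Z l ω = (i, j))).card : ℝ) / N *
        Real.log (π θ i (σ⁻¹ j)) := by
  simp only [llik, Finset.mul_sum]
  refine Finset.sum_congr rfl fun i _ => Finset.sum_congr rfl fun j _ => ?_
  ring

/-- Asymptotic optimality of the true order and parameter.  With i.i.d. data
generated from the true parameter `θ₀` and true order `σ₀` (category probabilities
`p_{ij} = π θ₀ i (σ₀⁻¹ j)`), and `(θ̂_N, σ̂_N)` maximum likelihood estimates for every
outcome and every `N`, almost surely: `N⁻¹ |l_N(θ̂_N, σ̂_N) − l_N(θ₀, σ₀)| → 0`,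
`N⁻¹ l_N(θ̂_N, σ̂_N) → l_0`, and `l_N(θ₀, σ₀) / l_N(θ̂_N, σ̂_N) → 1`, where
`l_0 = Σ_{i,j} w_i p_{ij} log p_{ij} < 0`. -/
theorem mle_asymptotically_attains_true_loglik
    {Ω : Type*} [MeasurableSpace Ω] (P : Measure Ω) [IsProbabilityMeasure P]
    (m J : ℕ) (hm : 1 ≤ m) (hJ : 3 ≤ J)
    (w : Fin m → ℝ) (hw : ∀ i, 0 < w i) (hwsum : ∑ i, w i = 1)
    {Θ : Type*} [Nonempty Θ]
    (π : Θ → Fin m → Fin J → ℝ)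
    (hpos : ∀ (θ : Θ) (i : Fin m) (j : Fin J), 0 < π θ i j)
    (hsum : ∀ (θ : Θ) (i : Fin m), ∑ j, π θ i j = 1)
    (θ₀ : Θ) (σ₀ : Equiv.Perm (Fin J))
    (Z : ℕ → Ω → Fin m × Fin J)
    (hmeas : ∀ l, Measurable (Z l))
    (hindep : iIndepFun Z P)
    (hdist : ∀ (l : ℕ) (i : Fin m) (j : Fin J),
      P {ω | Z l ω = (i, j)} = ENNReal.ofReal (w i * π θ₀ i (σ₀⁻¹ j)))
    (θhat : ℕ → Ω → Θ) (σhat : ℕ → Ω → Equiv.Perm (Fin J))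
    (hmle : ∀ (ω : Ω) (N : ℕ) (θ : Θ) (σ : Equiv.Perm (Fin J)),
      llik Z π N ω θ σ ≤ llik Z π N ω (θhat N ω) (σhat N ω)) :
    (∑ i, ∑ j, w i * π θ₀ i (σ₀⁻¹ j) * Real.log (π θ₀ i (σ₀⁻¹ j))) < 0 ∧
      ∀ᵐ ω ∂P,
        Tendsto (fun N : ℕ => (N : ℝ)⁻¹ *
            |llik Z π N ω (θhat N ω) (σhat N ω) - llik Z π N ω θ₀ σ₀|)
          atTop (nhds 0) ∧
        Tendsto (fun N : ℕ => (N : ℝ)⁻¹ * llik Z π N ω (θhat N ω) (σhat N ω))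
          atTop (nhds (∑ i, ∑ j, w i * π θ₀ i (σ₀⁻¹ j) * Real.log (π θ₀ i (σ₀⁻¹ j)))) ∧
        Tendsto (fun N : ℕ => llik Z π N ω θ₀ σ₀ / llik Z π N ω (θhat N ω) (σhat N ω))
          atTop (nhds 1) := by
  have hq : ∀ i j, 0 < π θ₀ i (σ₀⁻¹ j) := fun i j => hpos _ _ _
  have hperm : ∀ (θ : Θ) (σ : Equiv.Perm (Fin J)) (i : Fin m), ∑ j, π θ i (σ⁻¹ j) = 1 :=
    fun θ σ i => (Equiv.sum_comp σ⁻¹ (π θ i)).trans (hsum θ i)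
  have hneg : (∑ i, ∑ j, w i * π θ₀ i (σ₀⁻¹ j) * Real.log (π θ₀ i (σ₀⁻¹ j))) < 0 := by
    have : Nontrivial (Fin J) := Fin.nontrivial_iff_two_le.2 (by omega)
    have : Nonempty (Fin m) := ⟨⟨0, hm⟩⟩
    refine Finset.sum_neg (fun i _ => Finset.sum_neg (fun j _ => ?_) Finset.univ_nonempty)
      Finset.univ_nonempty
    exact mul_neg_of_pos_of_neg (mul_pos (hw i) (hq i j))
      (Real.log_neg (hq i j) (lt_one_of_pos_of_sum_eq_one (hq i) (hperm θ₀ σ₀ i) j))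
  refine ⟨hneg, ?_⟩
  have hident : ∀ l, IdentDistrib (Z l) (Z 0) P P := fun l =>
    { aemeasurable_fst := (hmeas l).aemeasurable
      aemeasurable_snd := (hmeas 0).aemeasurable
      map_eq := by
        refine Measure.ext_of_singleton fun a => ?_
        rw [Measure.map_apply (hmeas l) (measurableSet_singleton a),
          Measure.map_apply (hmeas 0) (measurableSet_singleton a)]
        exact (hdist l a.1 a.2).trans (hdist 0 a.1 a.2).symm }
  have hfreq : ∀ᵐ ω ∂P, ∀ i j, Tendsto
      (fun N : ℕ => (((Finset.range N).filter (fun l => Z l ω = (i, j))).card : ℝ) / N)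
      atTop (nhds (w i * π θ₀ i (σ₀⁻¹ j))) := by
    refine ae_all_iff.2 fun i => ae_all_iff.2 fun j => ?_
    have h := tendsto_count_div_ae (fun k l hkl => hindep.indepFun hkl) hident (i, j)
    rwa [measureReal_def, hdist, ENNReal.toReal_ofReal (mul_pos (hw i) (hq i j)).le] at h
  filter_upwards [hfreq] with ω hω
  have htrue : Tendsto (fun N : ℕ => (N : ℝ)⁻¹ * llik Z π N ω θ₀ σ₀) atTop
      (nhds (∑ i, ∑ j, w i * π θ₀ i (σ₀⁻¹ j) * Real.log (π θ₀ i (σ₀⁻¹ j)))) := by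
    simp only [inv_mul_llik]
    exact tendsto_finsetSum _ fun i _ => tendsto_finsetSum _ fun j _ => (hω i j).mul_const _
  have hrow : ∀ i, Tendsto (fun N : ℕ => ∑ k,
      (((Finset.range N).filter (fun l => Z l ω = (i, k))).card : ℝ) / N) atTop
      (nhds (w i)) := by
    intro i
    have h := tendsto_finsetSum Finset.univ fun j _ => hω i j
    rwa [← Finset.mul_sum, hperm, mul_one] at h
  have hupper : Tendsto (fun N : ℕ => ∑ i, ∑ j,
      (((Finset.range N).filter (fun l => Z l ω = (i, j))).card : ℝ) / N *
        Real.log ((((Finset.range N).filter (fun l => Z l ω = (i, j))).card : ℝ) / N /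
          ∑ k, (((Finset.range N).filter (fun l => Z l ω = (i, k))).card : ℝ) / N)) atTop
      (nhds (∑ i, ∑ j, w i * π θ₀ i (σ₀⁻¹ j) * Real.log (π θ₀ i (σ₀⁻¹ j)))) := by
    refine tendsto_finsetSum _ fun i _ => tendsto_finsetSum _ fun j _ => (hω i j).mul ?_
    have h := (hω i j).div (hrow i) (hw i).ne'
    rw [mul_div_cancel_left₀ _ (hw i).ne'] at h
    exact h.log (hq i j).ne'
  have hhat : Tendsto (fun N : ℕ => (N : ℝ)⁻¹ * llik Z π N ω (θhat N ω) (σhat N ω)) atTop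
      (nhds (∑ i, ∑ j, w i * π θ₀ i (σ₀⁻¹ j) * Real.log (π θ₀ i (σ₀⁻¹ j)))) := by
    refine tendsto_of_tendsto_of_tendsto_of_le_of_le htrue hupper
      (fun N => mul_le_mul_of_nonneg_left (hmle ω N θ₀ σ₀) (by positivity)) fun N => ?_
    simp only [inv_mul_llik]
    exact Finset.sum_le_sum fun i _ => sum_mul_log_le_sum_mul_log_div_sum
      (fun j => by positivity) (fun j => hpos _ _ _) (hperm _ _ i)
  refine ⟨?_, hhat, ?_⟩
  · have h := (hhat.sub htrue).abs
    rw [sub_self, abs_zero] at h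
    refine h.congr fun N => ?_
    rw [← mul_sub, abs_mul, abs_of_nonneg (by positivity : (0 : ℝ) ≤ (N : ℝ)⁻¹)]
  · have h := htrue.div hhat hneg.ne
    rw [div_self hneg.ne] at h
    refine h.congr' ?_
    filter_upwards [eventually_ne_atTop 0] with N hN
    exact mul_div_mul_left _ _ (inv_ne_zero (Nat.cast_ne_zero.2 hN))
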